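/- arXiv:1903.07250 — 9 statements merged into one kernel-verified Lean document; each statement's English description precedes it below -/
import Mathlib

section
/- Let α>0, β>0, a>0, q>1 with β/(q-1)-α>0, θ>0, μ∈ℝ. Then the generalized q-logistic density f(y) = C e^{α(y-μ)/θ}[1+a(q-1)e^{(y-μ)/θ}]^{-β/(q-1)}, with C = [a(q-1)]^α Γ(β/(q-1)) / (θ Γ(α) Γ(β/(q-1)-α)), integrates to 1 over ℝ, i.e., ∫_{-∞}^{∞} f(y) dy = 1. -/
open MeasureTheory Real

open ProbabilityTheory in
theorem setIntegral_Ioo_rpow_mul_one_sub_rpow {a b : ℝ} (ha : 0 < a) (hb : 0 < b) :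
    ∫ x in Set.Ioo (0 : ℝ) 1, x ^ (a - 1) * (1 - x) ^ (b - 1) = beta a b := by
  have hβ := beta_pos ha hb
  have h : ∫ x in Set.Ioo (0 : ℝ) 1, 1 / beta a b * x ^ (a - 1) * (1 - x) ^ (b - 1) = 1 := by
    rw [integral_eq_lintegral_of_nonneg_ae, ← lintegral_betaPDF, lintegral_betaPDF_eq_one ha hb,
      ENNReal.toReal_one]
    · refine ae_restrict_of_forall_mem measurableSet_Ioo fun x hx ↦ ?_
      have h0 := hx.1
      have h1 := sub_pos.2 hx.2
      simp only [Pi.zero_apply]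
      positivity
    · exact Measurable.aestronglyMeasurable (by fun_prop)
  simp_rw [mul_assoc, integral_const_mul] at h
  field_simp at h
  exact h

theorem integral_sigmoid_rpow_mul_one_sub_sigmoid_rpow {a b : ℝ} (ha : 0 < a) (hb : 0 < b) :
    ∫ t : ℝ, sigmoid t ^ a * (1 - sigmoid t) ^ b = ProbabilityTheory.beta a b := by
  have h := integral_image_eq_integral_abs_deriv_smul MeasurableSet.univ
    (fun t _ ↦ (hasDerivAt_sigmoid t).hasDerivWithinAt) sigmoid_injective.injOn
    (fun x ↦ x ^ (a - 1) * (1 - x) ^ (b - 1))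
  rw [Set.image_univ, range_sigmoid, setIntegral_Ioo_rpow_mul_one_sub_rpow ha hb,
    setIntegral_univ] at h
  rw [h]
  refine integral_congr_ae (.of_forall fun t ↦ ?_)
  have h0 := sigmoid_pos t
  have h1 := sub_pos.2 (sigmoid_lt_one t)
  simp only [smul_eq_mul]
  rw [abs_of_pos (mul_pos h0 h1), rpow_sub_one h0.ne', rpow_sub_one h1.ne']
  field_simp

theorem integral_exp_mul_one_add_exp_rpow_neg {a p : ℝ} (ha : 0 < a) (hp : 0 < p - a) :
    ∫ t : ℝ, exp (a * t) * (1 + exp t) ^ (-p) = ProbabilityTheory.beta a (p - a) := by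
  rw [← integral_sigmoid_rpow_mul_one_sub_sigmoid_rpow ha hp]
  refine integral_congr_ae (.of_forall fun t ↦ ?_)
  have h1 : 1 - sigmoid t = (1 + exp t)⁻¹ := by rw [← sigmoid_neg, sigmoid_def, neg_neg]
  have h0 : sigmoid t = exp t * (1 + exp t)⁻¹ := by
    rw [sigmoid_def, exp_neg]
    field_simp
    ring
  have hpos : 0 < 1 + exp t := by positivity
  simp only
  rw [h1, h0, mul_rpow (exp_pos t).le (inv_pos.2 hpos).le, mul_assoc,
    ← rpow_add (inv_pos.2 hpos), add_sub_cancel, inv_rpow hpos.le, ← rpow_neg hpos.le,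
    ← exp_mul, mul_comm t a]

/-- The generalized q-logistic density integrates to 1 over ℝ. -/
theorem GqL_density_integrates_to_one
    (α β a q θ μ : ℝ) (hα : 0 < α) (hβ : 0 < β) (ha : 0 < a) (hq : 1 < q)
    (hβα : 0 < β / (q - 1) - α) (hθ : 0 < θ) :
    ∫ y : ℝ,
        ((a * (q - 1)) ^ α * Real.Gamma (β / (q - 1)) /
            (θ * Real.Gamma α * Real.Gamma (β / (q - 1) - α))) *
          (Real.exp (α * (y - μ) / θ) *
            (1 + a * (q - 1) * Real.exp ((y - μ) / θ)) ^ (-(β / (q - 1)))) = 1 := by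
  have hc : 0 < a * (q - 1) := mul_pos ha (sub_pos.2 hq)
  have hp : 0 < β / (q - 1) := div_pos hβ (sub_pos.2 hq)
  generalize β / (q - 1) = p at *
  generalize a * (q - 1) = c at *
  have hcα : 0 < c ^ α := rpow_pos_of_pos hc α
  have key : ∀ y : ℝ, exp (α * (y - μ) / θ) * (1 + c * exp ((y - μ) / θ)) ^ (-p) =
      (c ^ α)⁻¹ * (fun t ↦ exp (α * t) * (1 + exp t) ^ (-p)) ((y - μ) / θ + log c) := by
    intro y
    simp only
    rw [mul_add, exp_add, exp_add, exp_log hc, mul_comm α (log c), ← rpow_def_of_pos hc,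
      mul_comm c, mul_div_assoc]
    field_simp
  simp_rw [key]
  rw [integral_const_mul, integral_const_mul,
    integral_sub_right_eq_self (fun y ↦ (fun t ↦ exp (α * t) * (1 + exp t) ^ (-p))
      (y / θ + log c)) μ,
    Measure.integral_comp_div (fun y ↦ (fun t ↦ exp (α * t) * (1 + exp t) ^ (-p))
      (y + log c)) θ,
    integral_add_right_eq_self (fun t ↦ exp (α * t) * (1 + exp t) ^ (-p)) (log c),
    integral_exp_mul_one_add_exp_rpow_neg hα hβα, ProbabilityTheory.beta, add_sub_cancel,
    abs_of_pos hθ, smul_eq_mul]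
  have h1 := Gamma_pos_of_pos hα
  have h2 := Gamma_pos_of_pos hβα
  have h3 := Gamma_pos_of_pos hp
  field_simp
end

section
/- Fix α>0, β>0, a>0, θ>0, μ∈ℝ and y∈ℝ. As q→1⁺, the generalized q-logistic density f_q(y) = ([a(q-1)]^α Γ(β/(q-1)) / (θ Γ(α) Γ(β/(q-1)-α))) e^{α(y-μ)/θ}[1+a(q-1)e^{(y-μ)/θ}]^{-β/(q-1)} converges pointwise to the generalized extreme value density f₁(y) = ((aβ)^α/(Γ(α)θ)) e^{α(y-μ)/θ} exp(-aβ e^{(y-μ)/θ}). -/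
open MeasureTheory Real Filter Topology

theorem log_Gamma_add_one_sub_log_Gamma {x : ℝ} (hx : 0 < x) :
    Real.log (Real.Gamma (x + 1)) - Real.log (Real.Gamma x) = Real.log x := by
  rw [Real.Gamma_add_one hx.ne', Real.log_mul hx.ne' (Real.Gamma_pos_of_pos hx).ne']
  ring

theorem Gamma_add_div_Gamma_le_rpow {x s : ℝ} (hx : 0 < x) (hs : 0 < s) :
    Real.Gamma (x + s) / Real.Gamma x ≤ (x + s) ^ s := by
  have hxs : 0 < x + s := by positivity
  have h := Real.convexOn_log_Gamma.slope_mono_adjacent (x := x) (y := x + s) (z := x + s + 1)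
    (Set.mem_Ioi.2 hx) (Set.mem_Ioi.2 (by positivity)) (by linarith) (by linarith)
  simp only [Function.comp_apply, add_sub_cancel_left, div_one,
    log_Gamma_add_one_sub_log_Gamma hxs] at h
  rw [div_le_iff₀ hs] at h
  rw [← Real.log_le_log_iff (div_pos (Real.Gamma_pos_of_pos hxs) (Real.Gamma_pos_of_pos hx))
    (by positivity), Real.log_div (Real.Gamma_pos_of_pos hxs).ne' (Real.Gamma_pos_of_pos hx).ne',
    Real.log_rpow hxs]
  linarith

theorem rpow_le_Gamma_add_div_Gamma {x s : ℝ} (hx : 1 < x) (hs : 0 < s) :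
    (x - 1) ^ s ≤ Real.Gamma (x + s) / Real.Gamma x := by
  have hx0 : 0 < x := by linarith
  have hx1 : 0 < x - 1 := by linarith
  have hxs : 0 < x + s := by positivity
  have h := Real.convexOn_log_Gamma.slope_mono_adjacent (x := x - 1) (y := x) (z := x + s)
    (Set.mem_Ioi.2 hx1) (Set.mem_Ioi.2 hxs) (by linarith) (by linarith)
  have h1 := log_Gamma_add_one_sub_log_Gamma hx1
  rw [sub_add_cancel] at h1
  simp only [Function.comp_apply, add_sub_cancel_left, sub_sub_cancel, div_one, h1] at h
  rw [le_div_iff₀ hs] at h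
  rw [← Real.log_le_log_iff (by positivity)
    (div_pos (Real.Gamma_pos_of_pos hxs) (Real.Gamma_pos_of_pos hx0)),
    Real.log_div (Real.Gamma_pos_of_pos hxs).ne' (Real.Gamma_pos_of_pos hx0).ne',
    Real.log_rpow hx1]
  linarith

theorem tendsto_Gamma_div_Gamma_sub_div_rpow {s : ℝ} (hs : 0 < s) :
    Tendsto (fun x : ℝ => Real.Gamma x / Real.Gamma (x - s) / x ^ s) atTop (𝓝 1) := by
  have hlow : Tendsto (fun x : ℝ => (1 - (s + 1) / x) ^ s) atTop (𝓝 1) := by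
    have h : Tendsto (fun x : ℝ => 1 - (s + 1) / x) atTop (𝓝 1) := by
      simpa using (tendsto_const_nhds (x := (1 : ℝ))).sub
        (tendsto_const_nhds (x := s + 1).div_atTop tendsto_id)
    simpa using h.rpow_const (p := s) (Or.inl one_ne_zero)
  refine tendsto_of_tendsto_of_tendsto_of_le_of_le' hlow tendsto_const_nhds ?_ ?_
  · filter_upwards [eventually_gt_atTop (s + 1)] with x hx
    have hx0 : 0 < x := by linarith
    have h := rpow_le_Gamma_add_div_Gamma (x := x - s) (by linarith) hs
    rw [sub_add_cancel] at h
    rw [le_div_iff₀ (by positivity), ← Real.mul_rpow _ hx0.le]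
    · rwa [sub_mul, one_mul, div_mul_cancel₀ _ hx0.ne', ← sub_sub]
    · rw [sub_nonneg, div_le_one hx0]
      exact hx.le
  · filter_upwards [eventually_gt_atTop s] with x hx
    have hx0 : 0 < x := by linarith
    have h := Gamma_add_div_Gamma_le_rpow (x := x - s) (by linarith) hs
    rw [sub_add_cancel] at h
    exact (div_le_one (by positivity)).2 h

/-- As q → 1⁺, the generalized q-logistic density converges pointwise to the
generalized extreme value density. -/
theorem GqL_tendsto_extreme_value
    (α β a θ μ y : ℝ) (hα : 0 < α) (hβ : 0 < β) (ha : 0 < a) (hθ : 0 < θ) :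
    Tendsto (fun q : ℝ =>
        ((a * (q - 1)) ^ α * Real.Gamma (β / (q - 1)) /
            (θ * Real.Gamma α * Real.Gamma (β / (q - 1) - α))) *
          (Real.exp (α * (y - μ) / θ) *
            (1 + a * (q - 1) * Real.exp ((y - μ) / θ)) ^ (-(β / (q - 1)))))
      (nhdsWithin 1 (Set.Ioi 1))
      (nhds ((a * β) ^ α / (Real.Gamma α * θ) *
        (Real.exp (α * (y - μ) / θ) *
          Real.exp (-(a * β * Real.exp ((y - μ) / θ)))))) := by
  have hx : Tendsto (fun q : ℝ => β / (q - 1)) (𝓝[>] 1) atTop := by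
    have h : Tendsto (fun q : ℝ => q - 1) (𝓝[>] 1) (𝓝[>] 0) := by
      refine tendsto_nhdsWithin_iff.2 ⟨?_, ?_⟩
      · exact tendsto_nhdsWithin_of_tendsto_nhds
          ((continuous_id.sub continuous_const).tendsto' 1 0 (by simp))
      · filter_upwards [self_mem_nhdsWithin] with q hq
        exact Set.mem_Ioi.2 (sub_pos.2 (Set.mem_Ioi.1 hq))
    simpa only [div_eq_mul_inv, Function.comp_def] using
      (tendsto_inv_nhdsGT_zero.comp h).const_mul_atTop hβ
  have hΓ := (tendsto_Gamma_div_Gamma_sub_div_rpow hα).comp hx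
  have hE := ((tendsto_one_add_div_rpow_exp (a * β * Real.exp ((y - μ) / θ))).comp hx).inv₀
    (Real.exp_ne_zero _)
  have h := (hΓ.const_mul ((a * β) ^ α / (Real.Gamma α * θ))).mul
    (hE.const_mul (Real.exp (α * (y - μ) / θ)))
  rw [mul_one, ← Real.exp_neg] at h
  refine h.congr' ?_
  filter_upwards [self_mem_nhdsWithin] with q hq
  have hq0 : 0 < q - 1 := sub_pos.2 (Set.mem_Ioi.1 hq)
  have hpow : (a * β) ^ α / (β / (q - 1)) ^ α = (a * (q - 1)) ^ α := by
    rw [← Real.div_rpow (by positivity) (by positivity)]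
    congr 1
    field_simp
  have hbase : a * β * Real.exp ((y - μ) / θ) / (β / (q - 1)) =
      a * (q - 1) * Real.exp ((y - μ) / θ) := by
    field_simp
  simp only [Function.comp_apply]
  rw [hbase, Real.rpow_neg (by positivity), ← hpow]
  congr 1
  simp only [div_eq_mul_inv, mul_inv]
  ring
end

section
/- Let α>0, β>0, a>0, q>1 with β/(q-1)-α>0, θ>0, μ∈ℝ, and let t∈ℝ satisfy a(q-1)e^{(t-μ)/θ} < 1. Then the cumulative distribution function F(t) = ∫_{-∞}^t f(y) dy of the generalized q-logistic density satisfies F(t) = (Γ(β/(q-1))/(Γ(α)Γ(β/(q-1)-α))) · ([a(q-1)e^{(t-μ)/θ}]^α/α) · ∑_{n=0}^{∞} [(α)_n (β/(q-1))_n / ((α+1)_n n!)] (-a(q-1)e^{(t-μ)/θ})^n, where (x)_n = x(x+1)⋯(x+n-1) denotes the Pochhammer symbol (so the sum is the Gauss hypergeometric series ₂F₁(α, β/(q-1); α+1; -a(q-1)e^{(t-μ)/θ})). -/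
open MeasureTheory Real

/-- The binomial series `∑ (b)ₙ / n! * xⁿ = (1 - x) ^ (-b)`, in terms of Pochhammer symbols. -/
theorem hasSum_ascPochhammer_div_factorial_mul_pow (b : ℝ) {x : ℝ} (hx : |x| < 1) :
    HasSum (fun n : ℕ ↦ (ascPochhammer ℝ n).eval b / (n.factorial : ℝ) * x ^ n)
      ((1 - x) ^ (-b)) := by
  have hmem : x ∈ Metric.eball (0 : ℝ) 1 := by
    simpa [enorm_eq_nnnorm, ← NNReal.coe_lt_coe] using hx
  have h := (one_div_one_sub_rpow_hasFPowerSeriesOnBall_zero b).hasSum hmem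
  have hpos : 0 ≤ 1 - x := by linarith [(abs_lt.mp hx).2]
  rw [zero_add, one_div, ← Real.rpow_neg hpos] at h
  refine h.congr_fun fun n ↦ ?_
  have hc : (n.factorial : ℝ) * Ring.choose (b + n - 1) n = (ascPochhammer ℝ n).eval b := by
    have := Ring.factorial_nsmul_multichoose_eq_ascPochhammer b n
    rw [nsmul_eq_mul, Polynomial.ascPochhammer_smeval_eq_eval] at this
    rw [← this, Ring.choose]
    ring_nf
  rw [← hc, mul_div_cancel_left₀ _ (by positivity)]
  simp [FormalMultilinearSeries.ofScalars]

theorem ascPochhammer_eval_div_eval_add_one {x : ℝ} (hx : 0 < x) (n : ℕ) :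
    (ascPochhammer ℝ n).eval x / (ascPochhammer ℝ n).eval (x + 1) = x / (x + n) := by
  have h₁ := ascPochhammer_succ_eval n x
  rw [ascPochhammer_succ_left] at h₁
  simp only [Polynomial.eval_mul, Polynomial.eval_X, Polynomial.eval_comp, Polynomial.eval_add,
    Polynomial.eval_one] at h₁
  have h₂ := ascPochhammer_pos n (x + 1) (by linarith)
  rw [div_eq_div_iff h₂.ne' (by positivity), h₁]

theorem hasSum_integral_exp_mul_one_add_exp_rpow {α b c k t : ℝ} (hα : 0 < α) (hb : 0 < b)
    (hc : 0 < c) (hk : 0 < k) (ht : c * Real.exp (k * t) < 1) :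
    HasSum
      (fun n : ℕ ↦ (ascPochhammer ℝ n).eval b / (n.factorial : ℝ) * (-c) ^ n *
        (Real.exp (k * (α + n) * t) / (k * (α + n))))
      (∫ y in Set.Iic t, Real.exp (k * α * y) * (1 + c * Real.exp (k * y)) ^ (-b)) := by
  set A : ℕ → ℝ := fun n ↦ (ascPochhammer ℝ n).eval b / (n.factorial : ℝ)
  have hA_nonneg (n : ℕ) : 0 ≤ A n := div_nonneg (ascPochhammer_pos n b hb).le (by positivity)
  have hkn (n : ℕ) : 0 < k * (α + n) := by positivity
  have hexp (n : ℕ) (y : ℝ) :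
      Real.exp (k * (α + n) * y) = Real.exp (k * α * y) * Real.exp (k * y) ^ n := by
    rw [← Real.exp_nat_mul, ← Real.exp_add]
    ring_nf
  have hint (n : ℕ) : ∫ y in Set.Iic t, Real.exp (k * (α + n) * y) =
      Real.exp (k * (α + n) * t) / (k * (α + n)) := integral_exp_mul_Iic (hkn n) t
  have hF_int (n : ℕ) : Integrable (fun y ↦ A n * (-c) ^ n * Real.exp (k * (α + n) * y))
      (volume.restrict (Set.Iic t)) := (integrableOn_exp_mul_Iic (hkn n) t).const_mul _
  have hF_sum : Summable fun n ↦
      ∫ y in Set.Iic t, ‖A n * (-c) ^ n * Real.exp (k * (α + n) * y)‖ := by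
    have hs := ((hasSum_ascPochhammer_div_factorial_mul_pow b (x := c * Real.exp (k * t))
      (by rwa [abs_of_pos (by positivity)])).summable).mul_left (Real.exp (k * α * t) / (k * α))
    refine hs.of_nonneg_of_le (fun n ↦ integral_nonneg fun y ↦ norm_nonneg _) fun n ↦ ?_
    have hnorm (y : ℝ) : ‖A n * (-c) ^ n * Real.exp (k * (α + n) * y)‖ =
        A n * c ^ n * Real.exp (k * (α + n) * y) := by
      simp [abs_of_nonneg (hA_nonneg n), abs_of_pos hc]
    simp_rw [hnorm]
    rw [integral_const_mul, hint, hexp]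
    calc A n * c ^ n * (Real.exp (k * α * t) * Real.exp (k * t) ^ n / (k * (α + n)))
        ≤ A n * c ^ n * (Real.exp (k * α * t) * Real.exp (k * t) ^ n / (k * α)) := by
          have := hA_nonneg n
          gcongr
          simp
      _ = _ := by rw [mul_pow]; ring
  have h := hasSum_integral_of_summable_integral_norm hF_int hF_sum
  simp_rw [integral_const_mul, hint] at h
  suffices hsum : Set.EqOn (fun y ↦ ∑' n, A n * (-c) ^ n * Real.exp (k * (α + n) * y))
      (fun y ↦ Real.exp (k * α * y) * (1 + c * Real.exp (k * y)) ^ (-b)) (Set.Iic t) by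
    rwa [setIntegral_congr_fun measurableSet_Iic hsum] at h
  intro y hy
  beta_reduce
  have hlt : c * Real.exp (k * y) < 1 := by
    refine lt_of_le_of_lt ?_ ht
    gcongr
    exact hy
  have hs := (hasSum_ascPochhammer_div_factorial_mul_pow b (x := -(c * Real.exp (k * y)))
    (by rwa [abs_neg, abs_of_pos (by positivity)])).mul_left (Real.exp (k * α * y))
  rw [sub_neg_eq_add] at hs
  rw [← hs.tsum_eq]
  refine tsum_congr fun n ↦ ?_
  rw [hexp, ← neg_mul, mul_pow]
  ring

/-- The CDF of the generalized q-logistic density expressed via the Gauss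
hypergeometric series ₂F₁(α, β/(q-1); α+1; -a(q-1)e^{(t-μ)/θ}). -/
theorem GqL_cdf_hypergeometric
    (α β a q θ μ t : ℝ) (hα : 0 < α) (hβ : 0 < β) (ha : 0 < a) (hq : 1 < q)
    (hβα : 0 < β / (q - 1) - α) (hθ : 0 < θ)
    (ht : a * (q - 1) * Real.exp ((t - μ) / θ) < 1) :
    (∫ y in Set.Iic t,
        ((a * (q - 1)) ^ α * Real.Gamma (β / (q - 1)) /
            (θ * Real.Gamma α * Real.Gamma (β / (q - 1) - α))) *
          (Real.exp (α * (y - μ) / θ) *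
            (1 + a * (q - 1) * Real.exp ((y - μ) / θ)) ^ (-(β / (q - 1))))) =
      (Real.Gamma (β / (q - 1)) /
          (Real.Gamma α * Real.Gamma (β / (q - 1) - α))) *
        ((a * (q - 1) * Real.exp ((t - μ) / θ)) ^ α / α) *
        ∑' n : ℕ,
          ((ascPochhammer ℝ n).eval α * (ascPochhammer ℝ n).eval (β / (q - 1)) /
              ((ascPochhammer ℝ n).eval (α + 1) * (n.factorial : ℝ))) *
            (-(a * (q - 1) * Real.exp ((t - μ) / θ))) ^ n := by
  have hc : 0 < a * (q - 1) := mul_pos ha (by linarith)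
  have hb : 0 < β / (q - 1) := div_pos hβ (by linarith)
  have hΓα := Real.Gamma_pos_of_pos hα
  have hΓ := Real.Gamma_pos_of_pos hβα
  set b := β / (q - 1)
  set c := a * (q - 1)
  have hshift (y : ℝ) : Real.exp (θ⁻¹ * y) * Real.exp (-(θ⁻¹ * μ)) = Real.exp ((y - μ) / θ) := by
    rw [← Real.exp_add]
    ring_nf
  have h := hasSum_integral_exp_mul_one_add_exp_rpow (c := c * Real.exp (-(θ⁻¹ * μ))) (t := t)
    hα hb (by positivity) (inv_pos.mpr hθ) (by rwa [mul_assoc, mul_comm (Real.exp _), hshift])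
  have hI : ∫ y in Set.Iic t, Real.exp (α * (y - μ) / θ) *
        (1 + c * Real.exp ((y - μ) / θ)) ^ (-b) =
      Real.exp (-(θ⁻¹ * α * μ)) * ∫ y in Set.Iic t, Real.exp (θ⁻¹ * α * y) *
        (1 + c * Real.exp (-(θ⁻¹ * μ)) * Real.exp (θ⁻¹ * y)) ^ (-b) := by
    rw [← integral_const_mul]
    congr 1 with y
    rw [mul_assoc c, mul_comm (Real.exp (-(θ⁻¹ * μ))), hshift, ← mul_assoc, ← Real.exp_add]
    ring_nf
  rw [integral_const_mul, hI, ← h.tsum_eq, ← tsum_mul_left, ← tsum_mul_left, ← tsum_mul_left]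
  refine tsum_congr fun n ↦ ?_
  have hpow : (c * Real.exp ((t - μ) / θ)) ^ α = c ^ α * Real.exp (α * ((t - μ) / θ)) := by
    rw [Real.mul_rpow hc.le (Real.exp_pos _).le, ← Real.exp_mul, mul_comm α]
  have hexp : Real.exp (-(θ⁻¹ * α * μ)) * (Real.exp (-(θ⁻¹ * μ)) ^ n *
      Real.exp (θ⁻¹ * (α + n) * t)) =
      Real.exp (α * ((t - μ) / θ)) * Real.exp ((t - μ) / θ) ^ n := by
    rw [← Real.exp_nat_mul, ← Real.exp_nat_mul, ← Real.exp_add, ← Real.exp_add, ← Real.exp_add]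
    ring_nf
  have hratio := ascPochhammer_eval_div_eval_add_one hα n
  rw [hpow, mul_div_mul_comm ((ascPochhammer ℝ n).eval α), hratio, neg_mul_eq_neg_mul c,
    neg_mul_eq_neg_mul c, mul_pow, mul_pow]
  have hαn : 0 < α + n := by positivity
  calc _ = c ^ α * Real.Gamma b / (θ * Real.Gamma α * Real.Gamma (b - α)) *
        ((ascPochhammer ℝ n).eval b / (n.factorial : ℝ)) * (-c) ^ n / (θ⁻¹ * (α + n)) *
        (Real.exp (-(θ⁻¹ * α * μ)) * (Real.exp (-(θ⁻¹ * μ)) ^ n *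
          Real.exp (θ⁻¹ * (α + n) * t))) := by ring
    _ = _ := by
      rw [hexp]
      field_simp
end

section
/- Let β>0, a>0, q>1 with β/(q-1) > 1, θ>0, μ∈ℝ. The function t ↦ -ln(1 - F₁(t)) = (β/(q-1) - 1) ln(1 + a(q-1)e^{(t-μ)/θ}) is convex on ℝ; hence the generalized q-logistic distribution with shape parameter α=1 belongs to the family of IFR (increasing failure rate) distributions. -/
open Real

theorem convexOn_log_one_add_mul_exp {c : ℝ} (hc : 0 ≤ c) :
    ConvexOn ℝ Set.univ (fun x : ℝ => Real.log (1 + c * Real.exp x)) := by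
  have hpos : ∀ x : ℝ, 0 < 1 + c * Real.exp x := fun x => by positivity
  have hderiv : ∀ x : ℝ, HasDerivAt (fun x : ℝ => Real.log (1 + c * Real.exp x))
      (c * Real.exp x / (1 + c * Real.exp x)) x := fun x =>
    (((Real.hasDerivAt_exp x).const_mul c).const_add 1).log (hpos x).ne'
  refine Monotone.convexOn_univ_of_deriv (fun x => (hderiv x).differentiableAt) ?_
  intro x y hxy
  rw [(hderiv x).deriv, (hderiv y).deriv, div_le_div_iff₀ (hpos x) (hpos y)]
  have hexp : c * Real.exp x ≤ c * Real.exp y := by gcongr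
  linarith

/-- The cumulative hazard t ↦ -ln(1-F₁(t)) = (β/(q-1)-1) ln(1+a(q-1)e^{(t-μ)/θ})
of the generalized q-logistic distribution with shape parameter α = 1 is convex
on ℝ; hence the distribution is IFR. -/
theorem GqL_cumulative_hazard_convex
    (β a q θ μ : ℝ) (hβ : 0 < β) (ha : 0 < a) (hq : 1 < q)
    (hβq : 1 < β / (q - 1)) (hθ : 0 < θ) :
    ConvexOn ℝ Set.univ (fun t : ℝ =>
      (β / (q - 1) - 1) * Real.log (1 + a * (q - 1) * Real.exp ((t - μ) / θ))) := by
  have hc : 0 ≤ a * (q - 1) := mul_nonneg ha.le (by linarith)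
  have hcoef : 0 ≤ β / (q - 1) - 1 := by linarith
  refine ConvexOn.smul hcoef ?_
  have h := (convexOn_log_one_add_mul_exp hc).comp_affineMap
    (AffineMap.lineMap (-μ / θ) ((1 - μ) / θ) : ℝ →ᵃ[ℝ] ℝ)
  rw [Set.preimage_univ] at h
  refine h.congr fun t _ => ?_
  simp only [Function.comp_apply, AffineMap.lineMap_apply, vsub_eq_sub, vadd_eq_add, smul_eq_mul]
  congr 4
  ring
end

section
/- (Theorem 1, direct part) Let β>0, a>0, q>1 with β/(q-1) > 1, θ>0, μ∈ℝ. If X is a random variable with exponential density f(x) = (β/(q-1)) e^{-(β/(q-1))x} on (0,∞), then Y = μ + θ ln[(e^X - 1)/(a(q-1))] has density f(y) = (aβ/θ) e^{(y-μ)/θ} [1+a(q-1)e^{(y-μ)/θ}]^{-(β/(q-1)+1)} for y∈ℝ; that is, the pushforward of the exponential measure under x ↦ μ + θ ln[(e^x-1)/(a(q-1))] has this generalized q-logistic density. -/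
open MeasureTheory Real

/-- Change of variables for a density pushed forward by a left inverse `g` of a differentiable
map `h`, when the density vanishes outside the range of `h`. -/
theorem map_withDensity_of_leftInverse {g h h' : ℝ → ℝ} {f : ℝ → ENNReal}
    (hg : Measurable g) (hh : ∀ y, HasDerivAt h (h' y) y) (hgh : Function.LeftInverse g h)
    (hf : ∀ x, x ∉ Set.range h → f x = 0) :
    Measure.map g (volume.withDensity f)
      = volume.withDensity (fun y => ENNReal.ofReal |h' y| * f (h y)) := by
  ext s hs
  rw [Measure.map_apply hg hs, withDensity_apply _ (hg hs), withDensity_apply _ hs,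
    ← lintegral_image_eq_lintegral_abs_deriv_mul hs (fun y _ => (hh y).hasDerivWithinAt)
      hgh.injective.injOn]
  have hims : MeasurableSet (h '' s) :=
    hs.image_of_continuousOn_injOn (fun y _ => (hh y).continuousAt.continuousWithinAt)
      hgh.injective.injOn
  rw [← lintegral_indicator (hg hs), ← lintegral_indicator hims]
  congr 1
  ext x
  by_cases hx : x ∈ Set.range h
  · obtain ⟨y, rfl⟩ := hx
    have hmem : h y ∈ g ⁻¹' s ↔ h y ∈ h '' s := by
      rw [hgh.injective.mem_set_image, Set.mem_preimage, hgh y]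
    by_cases hy : h y ∈ h '' s <;> simp only [Set.indicator, hmem, hy, if_true, if_false]
  · simp [Set.indicator, hf x hx]

/-- Theorem 1 (direct part): if X is exponential with rate β/(q-1), then
Y = μ + θ ln[(e^X - 1)/(a(q-1))] has the generalized q-logistic density
(aβ/θ) e^{(y-μ)/θ}[1+a(q-1)e^{(y-μ)/θ}]^{-(β/(q-1)+1)}. -/
theorem exp_to_GqL_pushforward
    (β a q θ μ : ℝ) (hβ : 0 < β) (ha : 0 < a) (hq : 1 < q)
    (hβq : 1 < β / (q - 1)) (hθ : 0 < θ) :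
    Measure.map (fun x : ℝ => μ + θ * Real.log ((Real.exp x - 1) / (a * (q - 1))))
      (volume.withDensity (fun x : ℝ => ENNReal.ofReal
        (if 0 < x then (β / (q - 1)) * Real.exp (-(β / (q - 1)) * x) else 0)))
    = volume.withDensity (fun y : ℝ => ENNReal.ofReal
        ((a * β / θ) * Real.exp ((y - μ) / θ) *
          (1 + a * (q - 1) * Real.exp ((y - μ) / θ)) ^ (-(β / (q - 1) + 1)))) := by
  have hq' : 0 < q - 1 := sub_pos.2 hq
  have hc : 0 < a * (q - 1) := mul_pos ha hq'
  have hpos : ∀ y : ℝ, 0 < a * (q - 1) * Real.exp ((y - μ) / θ) := fun y => by positivity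
  rw [map_withDensity_of_leftInverse
    (h := fun y => Real.log (1 + a * (q - 1) * Real.exp ((y - μ) / θ)))
    (h' := fun y => a * (q - 1) * (Real.exp ((y - μ) / θ) * (1 / θ)) /
      (1 + a * (q - 1) * Real.exp ((y - μ) / θ)))]
  · congr 1
    ext y
    have hy := hpos y
    have hy1 : 0 < 1 + a * (q - 1) * Real.exp ((y - μ) / θ) := by linarith
    rw [if_pos (Real.log_pos (by linarith)), ← ENNReal.ofReal_mul (abs_nonneg _),
      abs_of_pos (by positivity), mul_comm (-(β / (q - 1))), ← Real.rpow_def_of_pos hy1,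
      neg_add, Real.rpow_add hy1, Real.rpow_neg_one]
    congr 1
    field_simp
  · fun_prop
  · intro y
    have hy := hpos y
    exact (((((hasDerivAt_id y).sub_const μ).div_const θ).exp.const_mul _).const_add 1).log
      (by simp only [id]; linarith)
  · intro y
    have hy := hpos y
    simp only
    rw [Real.exp_log (by linarith), add_sub_cancel_left, mul_div_cancel_left₀ _ hc.ne',
      Real.log_exp]
    field_simp
    ring
  · intro x hx
    rw [if_neg, ENNReal.ofReal_zero]
    intro hx0
    have hx1 : 0 < Real.exp x - 1 := sub_pos.2 (Real.one_lt_exp_iff.2 hx0)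
    refine hx ⟨μ + θ * Real.log ((Real.exp x - 1) / (a * (q - 1))), ?_⟩
    simp only
    rw [add_sub_cancel_left, mul_div_cancel_left₀ _ hθ.ne', Real.exp_log (by positivity),
      mul_div_cancel₀ _ hc.ne', add_sub_cancel, Real.log_exp]
end

section
/- (Theorem 1, characteristic function) Let β>0, a>0, q>1, θ>0, μ∈ℝ, and let Y have density f(y) = (aβ/θ) e^{(y-μ)/θ}[1+a(q-1)e^{(y-μ)/θ}]^{-(β/(q-1)+1)} on ℝ. Then for every t∈ℝ with β/(q-1) > 0 one has E[e^{itY}] = ∫_{-∞}^∞ e^{ity} f(y) dy = e^{itμ} [a(q-1)]^{-itθ} Γ(1+itθ) Γ(β/(q-1) - itθ) / Γ(β/(q-1)), where Γ denotes the complex Gamma function and the complex power [a(q-1)]^{-itθ} = e^{-itθ ln(a(q-1))}. -/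
open MeasureTheory Real Complex

lemma Real.log_sigmoid (x : ℝ) : Real.log (Real.sigmoid x) = x - Real.log (1 + Real.exp x) := by
  have h : Real.sigmoid x = Real.exp x / (1 + Real.exp x) := by
    rw [Real.sigmoid_def, Real.exp_neg]
    field_simp
    ring
  rw [h, Real.log_div (Real.exp_pos x).ne' (by positivity), Real.log_exp]

lemma Real.log_one_sub_sigmoid (x : ℝ) :
    Real.log (1 - Real.sigmoid x) = -Real.log (1 + Real.exp x) := by
  rw [← Real.sigmoid_neg, Real.sigmoid_def, neg_neg, Real.log_inv]

lemma Complex.ofReal_cpow_eq_exp_log {x : ℝ} (hx : 0 < x) (s : ℂ) :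
    (x : ℂ) ^ s = Complex.exp (Real.log x * s) := by
  rw [Complex.cpow_def_of_ne_zero (by exact_mod_cast hx.ne'), Complex.ofReal_log hx.le]

/-- The Beta integral after the substitution `x = sigmoid w`. -/
lemma Complex.integral_exp_sub_log_one_add_exp (u v : ℂ) :
    ∫ w : ℝ, Complex.exp (u * w - (u + v) * Real.log (1 + Real.exp w)) =
      Complex.betaIntegral u v := by
  have key := integral_image_eq_integral_abs_deriv_smul MeasurableSet.univ
    (fun x _ ↦ (Real.hasDerivAt_sigmoid x).hasDerivWithinAt) Real.sigmoid_injective.injOn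
    (fun x : ℝ ↦ (x : ℂ) ^ (u - 1) * (1 - (x : ℂ)) ^ (v - 1))
  rw [Set.image_univ, Real.range_sigmoid, ← integral_Ioc_eq_integral_Ioo,
    ← intervalIntegral.integral_of_le zero_le_one, setIntegral_univ] at key
  rw [Complex.betaIntegral, key]
  refine integral_congr_ae (.of_forall fun w ↦ ?_)
  have h0 := Real.sigmoid_pos w
  have h1 : 0 < 1 - Real.sigmoid w := sub_pos.2 (Real.sigmoid_lt_one w)
  have e : ∀ {x : ℝ}, 0 < x → (x : ℂ) = Complex.exp (Real.log x) := fun {x} hx ↦ by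
    rw [← Complex.ofReal_exp, Real.exp_log hx]
  have h2 : (1 : ℂ) - (Real.sigmoid w : ℂ) = ((1 - Real.sigmoid w : ℝ) : ℂ) := by push_cast; rfl
  simp only [abs_of_pos (mul_pos h0 h1), Complex.real_smul]
  rw [h2, Complex.ofReal_cpow_eq_exp_log h0, Complex.ofReal_cpow_eq_exp_log h1,
    Complex.ofReal_mul, e h0, e h1, ← Complex.exp_add, ← Complex.exp_add, ← Complex.exp_add,
    Real.log_sigmoid, Real.log_one_sub_sigmoid]
  push_cast
  ring_nf

/-- Theorem 1 (characteristic function): if Y has the generalized q-logistic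
density (aβ/θ) e^{(y-μ)/θ}[1+a(q-1)e^{(y-μ)/θ}]^{-(β/(q-1)+1)}, then
E[e^{itY}] = e^{itμ}[a(q-1)]^{-itθ} Γ(1+itθ)Γ(β/(q-1)-itθ)/Γ(β/(q-1)). -/
theorem GqL_characteristic_function
    (β a q θ μ : ℝ) (hβ : 0 < β) (ha : 0 < a) (hq : 1 < q) (hθ : 0 < θ)
    (t : ℝ) (hβq : 0 < β / (q - 1)) :
    (∫ y : ℝ, Complex.exp (Complex.I * (t : ℂ) * (y : ℂ)) *
        (((a * β / θ) * Real.exp ((y - μ) / θ) *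
          (1 + a * (q - 1) * Real.exp ((y - μ) / θ)) ^ (-(β / (q - 1) + 1)) : ℝ) : ℂ)) =
      Complex.exp (Complex.I * (t : ℂ) * (μ : ℂ)) *
        Complex.exp (-(Complex.I * (t : ℂ) * (θ : ℂ)) * (Real.log (a * (q - 1)) : ℂ)) *
        Complex.Gamma (1 + Complex.I * (t : ℂ) * (θ : ℂ)) *
        Complex.Gamma (((β / (q - 1) : ℝ) : ℂ) - Complex.I * (t : ℂ) * (θ : ℂ)) /
        Complex.Gamma (((β / (q - 1) : ℝ) : ℂ)) := by
  have hq' : 0 < q - 1 := sub_pos.2 hq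
  have hc : 0 < a * (q - 1) := mul_pos ha hq'
  set p : ℝ := β / (q - 1) with hp
  set L : ℝ := Real.log (a * (q - 1)) with hL
  set u : ℂ := 1 + Complex.I * t * θ with hu
  set v : ℂ := (p : ℂ) - Complex.I * t * θ with hv
  have huv : u + v = p + 1 := by rw [hu, hv]; ring
  have hθ0 : (θ : ℂ) ≠ 0 := by exact_mod_cast hθ.ne'
  have hp0 : (p : ℂ) ≠ 0 := by exact_mod_cast hβq.ne'
  let g : ℝ → ℂ := fun w ↦ Complex.exp (u * w - (u + v) * Real.log (1 + Real.exp w))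
  have hg : ∫ y : ℝ, g (θ⁻¹ * y + (L - μ / θ)) = θ * Complex.betaIntegral u v := by
    rw [Measure.integral_comp_mul_left (fun x ↦ g (x + (L - μ / θ))) θ⁻¹,
      integral_add_right_eq_self g, Complex.integral_exp_sub_log_one_add_exp, inv_inv,
      abs_of_pos hθ, Complex.real_smul]
  have hint : ∀ y : ℝ, Complex.exp (Complex.I * (t : ℂ) * (y : ℂ)) *
        (((a * β / θ) * Real.exp ((y - μ) / θ) *
          (1 + a * (q - 1) * Real.exp ((y - μ) / θ)) ^ (-(p + 1)) : ℝ) : ℂ) =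
      (p / θ * Complex.exp (Complex.I * t * μ) * Complex.exp (-(Complex.I * t * θ) * L)) *
        g (θ⁻¹ * y + (L - μ / θ)) := by
    intro y
    set w : ℝ := θ⁻¹ * y + (L - μ / θ) with hw
    have hy : y = θ * (w - L) + μ := by rw [hw]; field_simp; ring
    have hz : (y - μ) / θ = w - L := by rw [hw]; field_simp; ring
    have hexp : a * (q - 1) * Real.exp (w - L) = Real.exp w := by
      rw [Real.exp_sub, hL, Real.exp_log hc]; field_simp
    have hdens : a * β / θ * Real.exp (w - L) = p / θ * Real.exp w := by
      rw [← hexp, hp]; field_simp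
    have hpos : 0 < 1 + Real.exp w := by positivity
    rw [hz, hexp, hdens, Real.rpow_def_of_pos hpos, hy]
    simp only [g, huv]
    push_cast
    have hcomb : Complex.exp (Complex.I * t * (θ * (w - L) + μ)) * (Complex.exp w *
          Complex.exp (Real.log (1 + Real.exp w) * -(p + 1))) =
        Complex.exp (Complex.I * t * μ) * (Complex.exp (-(Complex.I * t * θ) * L) *
          Complex.exp (u * w - (p + 1) * Real.log (1 + Real.exp w))) := by
      simp only [← Complex.exp_add, hu]
      ring_nf
    linear_combination (p / θ : ℂ) * hcomb
  rw [integral_congr_ae (.of_forall hint), integral_const_mul, hg,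
    Complex.betaIntegral_eq_Gamma_mul_div u v (by simp [hu]) (by simp [hv, hβq]), huv,
    Complex.Gamma_add_one _ hp0]
  field_simp
end

section
/- (Identity (11)) Let β>0, a>0, q>1, θ>0, μ∈ℝ, t∈ℝ. Then e^{itμ} ∫_0^∞ [(e^x - 1)/(a(q-1))]^{itθ} (β/(q-1)) e^{-(β/(q-1))x} dx = e^{itμ} [a(q-1)]^{-itθ} Γ(1+itθ) Γ(β/(q-1) - itθ) / Γ(β/(q-1)), where Γ denotes the complex Gamma function, and the complex powers w^{itθ} for w>0 are defined as e^{itθ ln w}. -/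
open MeasureTheory Real Complex

lemma image_exp_neg_Ioi_zero :
    Set.image (fun x : ℝ => Real.exp (-x)) (Set.Ioi 0) = Set.Ioo 0 1 := by
  ext y
  constructor
  · rintro ⟨x, hx, rfl⟩
    exact ⟨Real.exp_pos _, Real.exp_lt_one_iff.2 (neg_lt_zero.2 hx)⟩
  · rintro ⟨hy0, hy1⟩
    exact ⟨-Real.log y, neg_pos.2 (Real.log_neg hy0 hy1), by simp [Real.exp_log hy0]⟩

/-- The Beta integral after the substitution `y = exp (-x)`. -/
lemma betaIntegral_eq_integral_exp_neg (u v : ℂ) :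
    betaIntegral u v = ∫ x in Set.Ioi (0 : ℝ),
      Complex.exp (-(u * x)) * (1 - Complex.exp (-x)) ^ (v - 1) := by
  rw [betaIntegral, intervalIntegral.integral_of_le zero_le_one, integral_Ioc_eq_integral_Ioo,
    ← image_exp_neg_Ioi_zero, integral_image_eq_integral_abs_deriv_smul
      (f' := fun x => -Real.exp (-x)) measurableSet_Ioi
      (fun x _ => by simpa using ((hasDerivAt_neg x).exp).hasDerivWithinAt)
      (fun x _ y _ h => neg_injective (Real.exp_injective h))]
  refine setIntegral_congr_fun measurableSet_Ioi fun x _ => ?_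
  simp only [abs_neg, Real.abs_exp, real_smul]
  rw [← mul_assoc, cpow_def_of_ne_zero (by exact_mod_cast (Real.exp_pos (-x)).ne'),
    ← ofReal_log (Real.exp_pos _).le, Real.log_exp, ofReal_exp, ← Complex.exp_add]
  push_cast
  ring_nf

/-- The integral of `((exp x - 1) / c) ^ s` against the exponential density of rate `b`. -/
lemma integral_exp_sub_one_div_cpow_mul_exponential {b c : ℝ} {s : ℂ} (hb : 0 < b) (hc : 0 < c)
    (hs : -1 < s.re) (hsb : s.re < b) :
    ∫ x in Set.Ioi (0 : ℝ), Complex.exp (s * (Real.log ((Real.exp x - 1) / c) : ℂ)) *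
        ((b * Real.exp (-b * x) : ℝ) : ℂ) =
      Complex.exp (-s * (Real.log c : ℂ)) * Complex.Gamma (1 + s) * Complex.Gamma (b - s) /
        Complex.Gamma b := by
  have integrand_eq : ∀ x ∈ Set.Ioi (0 : ℝ),
      Complex.exp (s * (Real.log ((Real.exp x - 1) / c) : ℂ)) *
        ((b * Real.exp (-b * x) : ℝ) : ℂ) =
      (b * Complex.exp (-s * (Real.log c : ℂ))) *
        (Complex.exp (-((b - s) * x)) * (1 - Complex.exp (-x)) ^ ((1 + s) - 1)) := by
    intro x hx
    have hpos : 0 < 1 - Real.exp (-x) := sub_pos.2 (Real.exp_lt_one_iff.2 (neg_lt_zero.2 hx))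
    have hfac : Real.exp x - 1 = Real.exp x * (1 - Real.exp (-x)) := by
      rw [mul_sub, ← Real.exp_add]; simp
    have hcast : (1 - Complex.exp (-x) : ℂ) = ((1 - Real.exp (-x) : ℝ) : ℂ) := by push_cast; rfl
    rw [hfac, Real.log_div (mul_pos (Real.exp_pos x) hpos).ne' hc.ne',
      Real.log_mul (Real.exp_pos x).ne' hpos.ne', Real.log_exp, hcast,
      cpow_def_of_ne_zero (by exact_mod_cast hpos.ne'), ← ofReal_log hpos.le, ofReal_mul,
      ofReal_exp, mul_left_comm, mul_assoc, ← Complex.exp_add, ← Complex.exp_add,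
      ← Complex.exp_add]
    push_cast
    ring_nf
  have hb' : (b : ℂ) ≠ 0 := by exact_mod_cast hb.ne'
  rw [setIntegral_congr_fun measurableSet_Ioi integrand_eq, integral_const_mul,
    ← betaIntegral_eq_integral_exp_neg,
    betaIntegral_eq_Gamma_mul_div _ _ (by simpa using hsb) (by simp; linarith),
    show (b - s + (1 + s) : ℂ) = b + 1 by ring, Complex.Gamma_add_one _ hb']
  have hG : Complex.Gamma b ≠ 0 := Complex.Gamma_ne_zero_of_re_pos (by simpa using hb)
  field_simp

/-- Identity (11): e^{itμ} ∫₀^∞ [(e^x-1)/(a(q-1))]^{itθ} (β/(q-1)) e^{-(β/(q-1))x} dx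
= e^{itμ}[a(q-1)]^{-itθ} Γ(1+itθ)Γ(β/(q-1)-itθ)/Γ(β/(q-1)), with w^{itθ} = e^{itθ ln w}. -/
theorem GqL_characterization_identity
    (β a q θ μ t : ℝ) (hβ : 0 < β) (ha : 0 < a) (hq : 1 < q) (hθ : 0 < θ) :
    Complex.exp (Complex.I * (t : ℂ) * (μ : ℂ)) *
      (∫ x in Set.Ioi (0 : ℝ),
        Complex.exp (Complex.I * (t : ℂ) * (θ : ℂ) *
            (Real.log ((Real.exp x - 1) / (a * (q - 1))) : ℂ)) *
          (((β / (q - 1)) * Real.exp (-(β / (q - 1)) * x) : ℝ) : ℂ)) =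
    Complex.exp (Complex.I * (t : ℂ) * (μ : ℂ)) *
      Complex.exp (-(Complex.I * (t : ℂ) * (θ : ℂ)) * (Real.log (a * (q - 1)) : ℂ)) *
      Complex.Gamma (1 + Complex.I * (t : ℂ) * (θ : ℂ)) *
      Complex.Gamma (((β / (q - 1) : ℝ) : ℂ) - Complex.I * (t : ℂ) * (θ : ℂ)) /
      Complex.Gamma (((β / (q - 1) : ℝ) : ℂ)) := by
  have hre : (Complex.I * (t : ℂ) * (θ : ℂ)).re = 0 := by simp
  have hb : 0 < β / (q - 1) := div_pos hβ (sub_pos.2 hq)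
  rw [integral_exp_sub_one_div_cpow_mul_exponential hb (mul_pos ha (sub_pos.2 hq))
    (by rw [hre]; norm_num) (by rwa [hre])]
  ring
end

section
/- (Theorem 2, direct part) Let m>0, a>0, q>1, θ>0, μ∈ℝ. If X is a random variable with Student's t density with m degrees of freedom, f(x) = (Γ((m+1)/2)/(Γ(m/2)√(πm))) (1 + x²/m)^{-(m+1)/2} on ℝ, then Y = μ + θ ln[X²/(a m (q-1))] has density f(y) = (Γ((m+1)/2)/(Γ(m/2)Γ(1/2))) (√(a(q-1))/θ) e^{(y-μ)/(2θ)} [1 + a(q-1)e^{(y-μ)/θ}]^{-(m+1)/2} for y∈ℝ; that is, the pushforward of the t-distribution under x ↦ μ + θ ln[x²/(am(q-1))] has this generalized q-logistic density with parameters (1/2, (m+1)/2). -/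
open MeasureTheory Real

theorem lintegral_eq_two_mul_setLIntegral_Ioi_of_even {g : ℝ → ENNReal}
    (hg : ∀ x, g (-x) = g x) : ∫⁻ x, g x = 2 * ∫⁻ x in Set.Ioi (0 : ℝ), g x := by
  have h : ∫⁻ x in Set.Iio (0 : ℝ), g x = ∫⁻ x in Set.Ioi (0 : ℝ), g x := by
    have h' := lintegral_image_eq_lintegral_abs_deriv_mul (s := Set.Ioi (0 : ℝ)) measurableSet_Ioi
      (fun x _ => hasDerivWithinAt_neg x _) neg_injective.injOn g
    simpa [hg] using h'
  rw [← lintegral_add_compl g (measurableSet_Ioi (a := (0 : ℝ))), Set.compl_Ioi,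
    ← setLIntegral_congr (Iio_ae_eq_Iic (a := (0 : ℝ))), h, two_mul]

theorem setLIntegral_Ioi_eq_lintegral_comp_mul_exp {c θ : ℝ} (hc : 0 < c) (hθ : 0 < θ) (μ : ℝ)
    (g : ℝ → ENNReal) :
    ∫⁻ x in Set.Ioi (0 : ℝ), g x =
      ∫⁻ y, ENNReal.ofReal (c * exp ((y - μ) / (2 * θ)) / (2 * θ)) *
        g (c * exp ((y - μ) / (2 * θ))) := by
  have hderiv (y : ℝ) : HasDerivAt (fun y => c * exp ((y - μ) / (2 * θ)))
      (c * exp ((y - μ) / (2 * θ)) / (2 * θ)) y := by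
    convert! ((((hasDerivAt_id y).sub_const μ).div_const (2 * θ)).exp.const_mul c) using 1
    simp only [id_eq]
    ring
  have hinj : Function.Injective (fun y => c * exp ((y - μ) / (2 * θ))) := by
    intro y z hyz
    have h := exp_injective (mul_left_cancel₀ hc.ne' hyz)
    rw [div_left_inj' (by positivity)] at h
    linarith
  have himage : (fun y => c * exp ((y - μ) / (2 * θ))) '' Set.univ = Set.Ioi 0 := by
    ext x
    simp only [Set.image_univ, Set.mem_range, Set.mem_Ioi]
    refine ⟨fun ⟨y, hy⟩ => hy ▸ by positivity, fun hx => ⟨μ + 2 * θ * log (x / c), ?_⟩⟩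
    rw [add_sub_cancel_left, mul_div_cancel_left₀ _ (by positivity), exp_log (by positivity)]
    field_simp
  rw [← himage, lintegral_image_eq_lintegral_abs_deriv_mul MeasurableSet.univ
    (fun y _ => (hderiv y).hasDerivWithinAt) hinj.injOn, Measure.restrict_univ]
  refine lintegral_congr fun y => ?_
  rw [abs_of_pos (by positivity)]

theorem add_mul_log_sq_mul_exp_div {c θ : ℝ} (hc : 0 < c) (hθ : 0 < θ) (μ y : ℝ) :
    μ + θ * log ((√c * exp ((y - μ) / (2 * θ))) ^ 2 / c) = y := by
  rw [mul_pow, sq_sqrt hc.le, mul_div_cancel_left₀ _ hc.ne', log_pow, log_exp]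
  push_cast
  field_simp
  ring

theorem map_add_mul_log_sq_div_withDensity_of_even {c θ : ℝ} (hc : 0 < c) (hθ : 0 < θ) (μ : ℝ)
    {g : ℝ → ENNReal} (hg : ∀ x, g (-x) = g x) :
    Measure.map (fun x : ℝ => μ + θ * log (x ^ 2 / c)) (volume.withDensity g) =
      volume.withDensity (fun y => 2 *
        (ENNReal.ofReal (√c * exp ((y - μ) / (2 * θ)) / (2 * θ)) *
          g (√c * exp ((y - μ) / (2 * θ))))) := by
  have hT : Measurable (fun x : ℝ => μ + θ * log (x ^ 2 / c)) := by fun_prop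
  ext s hs
  rw [Measure.map_apply hT hs, withDensity_apply _ (hT hs), withDensity_apply _ hs,
    ← lintegral_indicator (hT hs), ← lintegral_indicator hs,
    lintegral_eq_two_mul_setLIntegral_Ioi_of_even,
    setLIntegral_Ioi_eq_lintegral_comp_mul_exp (sqrt_pos.2 hc) hθ μ,
    ← lintegral_const_mul' _ _ (by simp)]
  · refine lintegral_congr fun y => ?_
    by_cases hy : y ∈ s <;>
      simp [Set.indicator, add_mul_log_sq_mul_exp_div hc hθ, hy]
  · intro x
    by_cases hx : μ + θ * log (x ^ 2 / c) ∈ s <;> simp [Set.indicator, hg, hx]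

/-- Theorem 2 (direct part): if X has Student's t density with m degrees of
freedom, then Y = μ + θ ln[X²/(am(q-1))] has the generalized q-logistic density
with parameters (1/2, (m+1)/2). -/
theorem t_to_GqL_pushforward
    (m a q θ μ : ℝ) (hm : 0 < m) (ha : 0 < a) (hq : 1 < q) (hθ : 0 < θ) :
    Measure.map (fun x : ℝ => μ + θ * Real.log (x ^ 2 / (a * m * (q - 1))))
      (volume.withDensity (fun x : ℝ => ENNReal.ofReal
        ((Real.Gamma ((m + 1) / 2) / (Real.Gamma (m / 2) * Real.sqrt (Real.pi * m))) *
          (1 + x ^ 2 / m) ^ (-((m + 1) / 2)))))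
    = volume.withDensity (fun y : ℝ => ENNReal.ofReal
        ((Real.Gamma ((m + 1) / 2) / (Real.Gamma (m / 2) * Real.Gamma (1 / 2))) *
          (Real.sqrt (a * (q - 1)) / θ) * Real.exp ((y - μ) / (2 * θ)) *
          (1 + a * (q - 1) * Real.exp ((y - μ) / θ)) ^ (-((m + 1) / 2)))) := by
  have hq' : 0 < q - 1 := sub_pos.2 hq
  rw [map_add_mul_log_sq_div_withDensity_of_even (by positivity) hθ μ (fun x => by rw [neg_sq])]
  congr 1
  funext y
  have hexp : exp ((y - μ) / (2 * θ)) ^ 2 = exp ((y - μ) / θ) := by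
    rw [← exp_nat_mul]
    push_cast
    field_simp
  have hsq : (√(a * m * (q - 1)) * exp ((y - μ) / (2 * θ))) ^ 2 / m =
      a * (q - 1) * exp ((y - μ) / θ) := by
    rw [mul_pow, sq_sqrt (by positivity), hexp]
    field_simp
  have hsqrt : √(a * m * (q - 1)) = √m * √(a * (q - 1)) := by
    rw [← sqrt_mul hm.le]
    ring_nf
  rw [hsq, ← ENNReal.ofReal_mul (by positivity), ← ENNReal.ofReal_ofNat 2,
    ← ENNReal.ofReal_mul (by positivity), hsqrt, sqrt_mul pi_pos.le, Gamma_one_half_eq]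
  congr 1
  have hm' : √m ≠ 0 := (sqrt_pos.2 hm).ne'
  field_simp
end

section
/- (Theorem 2, characteristic function) Let m>0, a>0, q>1, θ>0, μ∈ℝ, and let X have Student's t density with m degrees of freedom. Then for every t∈ℝ, E[e^{it(μ + θ ln[X²/(a(q-1)m)])}] = ∫_{-∞}^∞ e^{it(μ+θ ln(x²/(a(q-1)m)))} (Γ((m+1)/2)/(Γ(m/2)√(πm))) (1+x²/m)^{-(m+1)/2} dx = e^{itμ} [a(q-1)]^{-itθ} Γ(itθ + 1/2) Γ(m/2 - itθ) / (Γ(m/2) Γ(1/2)), where the Gamma functions on the right are the complex Gamma function and [a(q-1)]^{-itθ} = e^{-itθ ln(a(q-1))}. -/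
open MeasureTheory Real Complex

open Set in
/-- The integral over the line of an even function integrable on the positive half-line. -/
theorem integral_eq_two_mul_integral_Ioi_of_even {f : ℝ → ℂ} (hf : ∀ x, f (-x) = f x)
    (hi : IntegrableOn f (Ioi 0)) : ∫ x, f x = 2 * ∫ x in Ioi (0 : ℝ), f x := by
  have hleft : IntegrableOn f (Iic 0) := by
    have hi' : IntegrableOn f (Ioi (-0)) := by rwa [neg_zero]
    rw [integrableOn_Iic_iff_integrableOn_Iio]
    simpa only [hf] using hi'.comp_neg_Iio
  have heq : ∫ x in Iic (0 : ℝ), f x = ∫ x in Ioi (0 : ℝ), f x := by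
    simpa only [hf, neg_zero] using integral_comp_neg_Iic 0 f
  rw [← intervalIntegral.integral_Iic_add_Ioi hleft hi, heq, two_mul]

theorem hasDerivAt_sq_div_add_sq {m : ℝ} (hm : 0 < m) (x : ℝ) :
    HasDerivAt (fun y : ℝ => y ^ 2 / (m + y ^ 2)) (2 * x * m / (m + x ^ 2) ^ 2) x := by
  have hne : m + x ^ 2 ≠ 0 := by positivity
  convert! (hasDerivAt_pow 2 x).div ((hasDerivAt_pow 2 x).const_add m) hne using 1
  push_cast
  ring

open Set in
theorem injOn_sq_div_add_sq {m : ℝ} (hm : 0 < m) :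
    InjOn (fun x : ℝ => x ^ 2 / (m + x ^ 2)) (Ioi 0) := by
  intro x hx y hy hxy
  rw [mem_Ioi] at hx hy
  have hxne : m + x ^ 2 ≠ 0 := by positivity
  have hyne : m + y ^ 2 ≠ 0 := by positivity
  have h : x ^ 2 * (m + y ^ 2) = y ^ 2 * (m + x ^ 2) := (div_eq_div_iff hxne hyne).1 hxy
  have hsq : x ^ 2 = y ^ 2 := mul_left_cancel₀ hm.ne' (by linarith)
  exact (pow_left_inj₀ hx.le hy.le two_ne_zero).1 hsq

open Set in
theorem image_sq_div_add_sq_Ioi {m : ℝ} (hm : 0 < m) :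
    (fun x : ℝ => x ^ 2 / (m + x ^ 2)) '' Ioi 0 = Ioo 0 1 := by
  ext s
  simp only [mem_image, mem_Ioi, mem_Ioo]
  constructor
  · rintro ⟨x, hx, rfl⟩
    refine ⟨by positivity, ?_⟩
    rw [div_lt_one (by positivity)]
    linarith
  · rintro ⟨h0, h1⟩
    have h1' : 0 < 1 - s := sub_pos.2 h1
    have hpos : 0 < m * s / (1 - s) := by positivity
    refine ⟨√(m * s / (1 - s)), Real.sqrt_pos.2 hpos, ?_⟩
    rw [Real.sq_sqrt hpos.le]
    field_simp
    ring

/-- The beta integrand under the substitution `s = x ^ 2 / (m + x ^ 2)`. -/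
theorem abs_deriv_smul_betaIntegrand {m : ℝ} (hm : 0 < m) (w : ℂ) {x : ℝ} (hx : 0 < x) :
    |2 * x * m / (m + x ^ 2) ^ 2| •
      (((x ^ 2 / (m + x ^ 2) : ℝ) : ℂ) ^ (w + 1 / 2 - 1) *
        (1 - ((x ^ 2 / (m + x ^ 2) : ℝ) : ℂ)) ^ ((m / 2 : ℝ) - w - 1)) =
      ((2 / √m : ℝ) : ℂ) * (Complex.exp (w * (Real.log (x ^ 2 / m) : ℂ)) *
        (((1 + x ^ 2 / m) ^ (-((m + 1) / 2)) : ℝ) : ℂ)) := by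
  have hC : 0 < m + x ^ 2 := by positivity
  have hcoef : |2 * x * m / (m + x ^ 2) ^ 2| =
      2 * Real.exp (Real.log x + Real.log m - 2 * Real.log (m + x ^ 2)) := by
    rw [abs_of_pos (by positivity), Real.exp_sub, Real.exp_add, two_mul (Real.log (m + x ^ 2)),
      Real.exp_add, Real.exp_log hx, Real.exp_log hm, Real.exp_log hC]
    ring
  have hs : Real.log (x ^ 2 / (m + x ^ 2)) = 2 * Real.log x - Real.log (m + x ^ 2) := by
    rw [Real.log_div (by positivity) hC.ne', Real.log_pow]
    push_cast
    rfl
  have hsub : (1 : ℂ) - ((x ^ 2 / (m + x ^ 2) : ℝ) : ℂ) = ((m / (m + x ^ 2) : ℝ) : ℂ) := by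
    rw [← Complex.ofReal_one, ← Complex.ofReal_sub]
    congr 1
    field_simp
    ring
  have hcpow : ∀ {y : ℝ}, 0 < y → ∀ u : ℂ, (y : ℂ) ^ u = Complex.exp (Real.log y * u) := by
    intro y hy u
    rw [Complex.cpow_def_of_ne_zero (Complex.ofReal_ne_zero.2 hy.ne'), Complex.ofReal_log hy.le]
  have hsum : Real.log (1 + x ^ 2 / m) = Real.log (m + x ^ 2) - Real.log m := by
    rw [← Real.log_div hC.ne' hm.ne']
    congr 1
    field_simp
  have hsqrt : 2 / √m = 2 * Real.exp (-(Real.log m / 2)) := by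
    rw [Real.exp_neg, ← Real.log_sqrt hm.le, Real.exp_log (Real.sqrt_pos.2 hm), div_eq_mul_inv]
  have hq : Real.log (x ^ 2 / m) = 2 * Real.log x - Real.log m := by
    rw [Real.log_div (by positivity) hm.ne', Real.log_pow]
    push_cast
    rfl
  rw [hsub, hcpow (by positivity), hcpow (by positivity), hs, Real.log_div hm.ne' hC.ne', hcoef,
    hsqrt, hq, Real.rpow_def_of_pos (by positivity), hsum, Complex.real_smul]
  push_cast
  simp only [mul_assoc, ← Complex.exp_add]
  congr 2
  ring

open Set in
theorem integrableOn_Ioo_betaIntegrand {u v : ℂ} (hu : 0 < u.re) (hv : 0 < v.re) :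
    IntegrableOn (fun s : ℝ => (s : ℂ) ^ (u - 1) * (1 - (s : ℂ)) ^ (v - 1)) (Ioo 0 1) :=
  ((intervalIntegrable_iff_integrableOn_Ioc_of_le zero_le_one).1
    (Complex.betaIntegral_convergent hu hv)).mono_set Ioo_subset_Ioc_self

open Set in
theorem integrableOn_Ioi_exp_log_sq_mul_rpow {m : ℝ} (hm : 0 < m) {w : ℂ}
    (hw : 0 < (w + 1 / 2).re) (hw' : 0 < (((m / 2 : ℝ) : ℂ) - w).re) :
    IntegrableOn (fun x : ℝ => Complex.exp (w * (Real.log (x ^ 2 / m) : ℂ)) *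
      (((1 + x ^ 2 / m) ^ (-((m + 1) / 2)) : ℝ) : ℂ)) (Ioi 0) := by
  have h := integrableOn_Ioo_betaIntegrand hw hw'
  rw [← image_sq_div_add_sq_Ioi hm, integrableOn_image_iff_integrableOn_abs_deriv_smul
    measurableSet_Ioi (fun x _ => (hasDerivAt_sq_div_add_sq hm x).hasDerivWithinAt)
    (injOn_sq_div_add_sq hm)] at h
  replace h := h.congr_fun (fun x hx => abs_deriv_smul_betaIntegrand hm w hx) measurableSet_Ioi
  have hne : ((2 / √m : ℝ) : ℂ) ≠ 0 := Complex.ofReal_ne_zero.2 (by positivity)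
  simpa only [IntegrableOn, inv_mul_cancel_left₀ hne] using h.const_mul ((2 / √m : ℝ) : ℂ)⁻¹

open Set in
theorem integral_Ioi_exp_log_sq_mul_rpow {m : ℝ} (hm : 0 < m) (w : ℂ) :
    ((2 / √m : ℝ) : ℂ) * ∫ x in Ioi (0 : ℝ), Complex.exp (w * (Real.log (x ^ 2 / m) : ℂ)) *
      (((1 + x ^ 2 / m) ^ (-((m + 1) / 2)) : ℝ) : ℂ) =
      Complex.betaIntegral (w + 1 / 2) ((m / 2 : ℝ) - w) := by
  rw [Complex.betaIntegral, intervalIntegral.integral_of_le zero_le_one,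
    integral_Ioc_eq_integral_Ioo, ← image_sq_div_add_sq_Ioi hm,
    integral_image_eq_integral_abs_deriv_smul measurableSet_Ioi
      (fun x _ => (hasDerivAt_sq_div_add_sq hm x).hasDerivWithinAt) (injOn_sq_div_add_sq hm),
    setIntegral_congr_fun measurableSet_Ioi
      (fun x hx => abs_deriv_smul_betaIntegrand hm w hx), integral_const_mul]

/-- A complex moment of `x ^ 2 / m` against the unnormalized Student density. -/
theorem integral_exp_log_sq_mul_rpow {m : ℝ} (hm : 0 < m) {w : ℂ}
    (hw : 0 < (w + 1 / 2).re) (hw' : 0 < (((m / 2 : ℝ) : ℂ) - w).re) :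
    ∫ x : ℝ, Complex.exp (w * (Real.log (x ^ 2 / m) : ℂ)) *
      (((1 + x ^ 2 / m) ^ (-((m + 1) / 2)) : ℝ) : ℂ) =
      (√m : ℂ) * (Complex.Gamma (w + 1 / 2) * Complex.Gamma ((m / 2 : ℝ) - w) /
        (Real.Gamma ((m + 1) / 2) : ℂ)) := by
  have hGamma : (Real.Gamma ((m + 1) / 2) : ℂ) =
      Complex.Gamma (w + 1 / 2 + ((m / 2 : ℝ) - w)) := by
    rw [← Complex.Gamma_ofReal]
    congr 1
    push_cast
    ring
  have hsqrt : (√m : ℂ) ≠ 0 := Complex.ofReal_ne_zero.2 (by positivity)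
  rw [integral_eq_two_mul_integral_Ioi_of_even (by simp)
    (integrableOn_Ioi_exp_log_sq_mul_rpow hm hw hw'), hGamma,
    ← Complex.betaIntegral_eq_Gamma_mul_div _ _ hw hw', ← integral_Ioi_exp_log_sq_mul_rpow hm w]
  push_cast
  field_simp

/-- Theorem 2 (characteristic function): if X has Student's t density with m
degrees of freedom, then E[e^{it(μ+θ ln(X²/(a(q-1)m)))}]
= e^{itμ}[a(q-1)]^{-itθ} Γ(itθ+1/2)Γ(m/2-itθ)/(Γ(m/2)Γ(1/2)). -/
theorem t_GqL_characteristic_function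
    (m a q θ μ t : ℝ) (hm : 0 < m) (ha : 0 < a) (hq : 1 < q) (hθ : 0 < θ) :
    (∫ x : ℝ, Complex.exp (Complex.I * (t : ℂ) *
          ((μ + θ * Real.log (x ^ 2 / (a * (q - 1) * m)) : ℝ) : ℂ)) *
        (((Real.Gamma ((m + 1) / 2) / (Real.Gamma (m / 2) * Real.sqrt (Real.pi * m))) *
            (1 + x ^ 2 / m) ^ (-((m + 1) / 2)) : ℝ) : ℂ)) =
      Complex.exp (Complex.I * (t : ℂ) * (μ : ℂ)) *
        Complex.exp (-(Complex.I * (t : ℂ) * (θ : ℂ)) * (Real.log (a * (q - 1)) : ℂ)) *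
        Complex.Gamma (Complex.I * (t : ℂ) * (θ : ℂ) + 1 / 2) *
        Complex.Gamma (((m / 2 : ℝ) : ℂ) - Complex.I * (t : ℂ) * (θ : ℂ)) /
        (Complex.Gamma (((m / 2 : ℝ) : ℂ)) * Complex.Gamma ((1 / 2 : ℂ))) := by
  have hb : 0 < a * (q - 1) := mul_pos ha (sub_pos.2 hq)
  have hint : ∀ᵐ x : ℝ, Complex.exp (Complex.I * (t : ℂ) *
          ((μ + θ * Real.log (x ^ 2 / (a * (q - 1) * m)) : ℝ) : ℂ)) *
        (((Real.Gamma ((m + 1) / 2) / (Real.Gamma (m / 2) * Real.sqrt (Real.pi * m))) *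
            (1 + x ^ 2 / m) ^ (-((m + 1) / 2)) : ℝ) : ℂ) =
      Complex.exp (Complex.I * (t : ℂ) * (μ : ℂ)) *
        Complex.exp (-(Complex.I * (t : ℂ) * (θ : ℂ)) * (Real.log (a * (q - 1)) : ℂ)) *
        ((Real.Gamma ((m + 1) / 2) / (Real.Gamma (m / 2) * Real.sqrt (Real.pi * m)) : ℝ) : ℂ) *
        (Complex.exp (Complex.I * (t : ℂ) * (θ : ℂ) * (Real.log (x ^ 2 / m) : ℂ)) *
          (((1 + x ^ 2 / m) ^ (-((m + 1) / 2)) : ℝ) : ℂ)) := by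
    filter_upwards [compl_mem_ae_iff.2 (measure_singleton (0 : ℝ))] with x hx
    have hx0 : x ≠ 0 := hx
    have hlog : Real.log (x ^ 2 / (a * (q - 1) * m)) =
        Real.log (x ^ 2 / m) - Real.log (a * (q - 1)) := by
      rw [← Real.log_div (by positivity) hb.ne', div_div, mul_comm m]
    have hexp : Complex.exp (Complex.I * (t : ℂ) *
          ((μ + θ * Real.log (x ^ 2 / (a * (q - 1) * m)) : ℝ) : ℂ)) =
        Complex.exp (Complex.I * (t : ℂ) * (μ : ℂ)) *
          Complex.exp (-(Complex.I * (t : ℂ) * (θ : ℂ)) * (Real.log (a * (q - 1)) : ℂ)) *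
          Complex.exp (Complex.I * (t : ℂ) * (θ : ℂ) * (Real.log (x ^ 2 / m) : ℂ)) := by
      rw [hlog, ← Complex.exp_add, ← Complex.exp_add]
      congr 1
      push_cast
      ring
    rw [hexp, Complex.ofReal_mul]
    ring
  have hw : 0 < (Complex.I * (t : ℂ) * (θ : ℂ) + 1 / 2).re := by simp
  have hw' : 0 < (((m / 2 : ℝ) : ℂ) - Complex.I * (t : ℂ) * (θ : ℂ)).re := by
    rw [Complex.sub_re, Complex.ofReal_re]
    simpa using hm
  have hhalf : Complex.Gamma (1 / 2) = (√Real.pi : ℂ) := by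
    rw [← Real.Gamma_one_half_eq, ← Complex.Gamma_ofReal]
    norm_num
  have hnum : (Real.Gamma ((m + 1) / 2) : ℂ) ≠ 0 :=
    Complex.ofReal_ne_zero.2 (Real.Gamma_pos_of_pos (by positivity)).ne'
  have hsqrt : (√m : ℂ) ≠ 0 := Complex.ofReal_ne_zero.2 (by positivity)
  rw [integral_congr_ae hint, integral_const_mul, integral_exp_log_sq_mul_rpow hm hw hw', hhalf,
    Complex.Gamma_ofReal, Real.sqrt_mul Real.pi_pos.le, Complex.ofReal_div, Complex.ofReal_mul,
    Complex.ofReal_mul]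
  field_simp
end
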